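/- Under the hypotheses of the basic estimate (Proposition 1), every vertical affine subspace g + V' of Y intersects every sheet F(v + W) at exactly one point; that is, for each g ∈ Y and v ∈ V there exists a unique w ∈ W such that F(v + w) ∈ g + V'. -/

import Mathlib

open scoped RealInnerProductSpace
open Filter

/-- A map on a Hilbert space whose derivatives are uniformly bounded and uniformly coercive has
exactly one zero. -/
theorem existsUnique_zero_of_hasFDerivAt_of_coercive
    {H : Type*} [NormedAddCommGroup H] [InnerProductSpace ℝ H] [CompleteSpace H]
    {Φ : H → H} {A : H → H →L[ℝ] H} (hΦ : ∀ u, HasFDerivAt Φ (A u) u)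
    {c K : ℝ} (hc : 0 < c) (hcoer : ∀ u h, c * ‖h‖ ^ 2 ≤ ⟪A u h, h⟫)
    (hK : ∀ u, ‖A u‖ ≤ K) : ∃! u, Φ u = 0 := by
  obtain ⟨M, hM, hcM, hKM⟩ : ∃ M : ℝ, 0 < M ∧ c < M ∧ ∀ u, ‖A u‖ ≤ M :=
    ⟨max K (c + 1), lt_max_of_lt_right (by linarith), lt_max_of_lt_right (by linarith),
      fun u => (hK u).trans (le_max_left _ _)⟩
  set τ : ℝ := c / M ^ 2 with hτ
  have hτ0 : 0 < τ := by positivity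
  set k : ℝ := 1 - c ^ 2 / M ^ 2 with hk
  have hk1 : k < 1 := by
    have : 0 < c ^ 2 / M ^ 2 := by positivity
    linarith
  have hk0 : 0 ≤ k := by
    have : c ^ 2 / M ^ 2 ≤ 1 := by
      rw [div_le_one (by positivity)]
      gcongr
    linarith
  have hderiv : ∀ u, HasFDerivAt (fun u => u - τ • Φ u)
      (ContinuousLinearMap.id ℝ H - τ • A u) u := fun u =>
    (hasFDerivAt_id u).sub ((hΦ u).const_smul τ)
  have hnorm : ∀ u, ‖ContinuousLinearMap.id ℝ H - τ • A u‖ ≤ √k := by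
    intro u
    refine ContinuousLinearMap.opNorm_le_bound _ (Real.sqrt_nonneg _) fun h => ?_
    refine abs_le_of_sq_le_sq' ?_ (by positivity) |>.2
    have hA : ‖A u h‖ ^ 2 ≤ M ^ 2 * ‖h‖ ^ 2 := by
      rw [← mul_pow]
      gcongr
      exact (A u).le_of_opNorm_le (hKM u) h
    have hexp : ‖h - τ • A u h‖ ^ 2 = ‖h‖ ^ 2 - 2 * τ * ⟪A u h, h⟫ + τ ^ 2 * ‖A u h‖ ^ 2 := by
      rw [norm_sub_sq_real, inner_smul_right, norm_smul, mul_pow, Real.norm_eq_abs, sq_abs,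
        real_inner_comm]
      ring
    have h1 : τ * (c * ‖h‖ ^ 2) ≤ τ * ⟪A u h, h⟫ := by
      gcongr
      exact hcoer u h
    have h2 : τ ^ 2 * ‖A u h‖ ^ 2 ≤ τ ^ 2 * (M ^ 2 * ‖h‖ ^ 2) := by gcongr
    have h3 : τ ^ 2 * (M ^ 2 * ‖h‖ ^ 2) = τ * (c * ‖h‖ ^ 2) := by
      rw [hτ]; field_simp
    have h4 : k * ‖h‖ ^ 2 = ‖h‖ ^ 2 - τ * (c * ‖h‖ ^ 2) := by
      rw [hk, hτ]; field_simp
    rw [mul_pow, Real.sq_sqrt hk0]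
    change ‖h - τ • A u h‖ ^ 2 ≤ _
    rw [hexp, h4]
    linarith
  have hcontr : ContractingWith (√k).toNNReal (fun u => u - τ • Φ u) := by
    refine ⟨?_, ?_⟩
    · rw [Real.toNNReal_lt_one, Real.sqrt_lt' one_pos]
      simpa using hk1
    · rw [← lipschitzOnWith_univ]
      refine convex_univ.lipschitzOnWith_of_nnnorm_hasFDerivWithin_le
        (fun u _ => (hderiv u).hasFDerivWithinAt) fun u _ => ?_
      rw [← NNReal.coe_le_coe, coe_nnnorm, Real.coe_toNNReal _ (Real.sqrt_nonneg _)]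
      exact hnorm u
  have hfix : ∀ u, Function.IsFixedPt (fun u => u - τ • Φ u) u ↔ Φ u = 0 := by
    intro u
    simp [Function.IsFixedPt, hτ0.ne']
  refine ⟨hcontr.fixedPoint, (hfix _).1 hcontr.fixedPoint_isFixedPt, fun u hu => ?_⟩
  exact hcontr.fixedPoint_unique ((hfix u).2 hu)

/-- A self-adjoint operator whose quadratic form is bounded by `M` has operator norm at most
`M`. -/
theorem IsSelfAdjoint.opNorm_le_of_abs_inner_le
    {H : Type*} [NormedAddCommGroup H] [InnerProductSpace ℝ H] [CompleteSpace H]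
    {B : H →L[ℝ] H} (hB : IsSelfAdjoint B) {M : ℝ} (hM : 0 ≤ M)
    (h : ∀ x, |⟪B x, x⟫| ≤ M * ‖x‖ ^ 2) : ‖B‖ ≤ M := by
  refine ContinuousLinearMap.opNorm_le_bound _ hM fun x => ?_
  rcases eq_or_ne (B x) 0 with h0 | h0
  · rw [h0, norm_zero]; positivity
  have hBx : 0 < ‖B x‖ := norm_pos_iff.2 h0
  set t : ℝ := ‖x‖ / ‖B x‖ with ht
  set y : H := t • B x with hy
  have hny : ‖y‖ = ‖x‖ := by
    rw [hy, norm_smul, ht, Real.norm_of_nonneg (by positivity)]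
    field_simp
  have hsymm : ⟪B y, x⟫ = ⟪B x, y⟫ := by
    rw [real_inner_comm]
    exact (hB.isSymmetric x y).symm
  have hinner : ⟪B x, y⟫ = ‖x‖ * ‖B x‖ := by
    rw [hy, inner_smul_right, real_inner_self_eq_norm_sq, ht]
    field_simp
  have h1 := (abs_le.1 (h (x + y))).2
  have h2 := (abs_le.1 (h (x - y))).1
  have h3 := parallelogram_law_with_norm ℝ x y
  simp only [map_add, map_sub, inner_add_left, inner_add_right, inner_sub_left, inner_sub_right,
    hsymm] at h1 h2
  have h4 : 4 * (‖x‖ * ‖B x‖) ≤ 4 * (M * (‖x‖ * ‖x‖)) := by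
    rw [hny] at h3
    rw [hinner] at h1 h2
    nlinarith
  have hx : 0 < ‖x‖ := by
    rw [norm_pos_iff]
    rintro rfl
    exact h0 (map_zero B)
  refine le_of_mul_le_mul_left ?_ hx
  linarith [mul_left_comm ‖x‖ M ‖x‖]

/-- A quadratic form diagonal in a complete orthonormal family is nonnegative at `x` as soon as
its coefficients are nonnegative wherever `x` has a nonzero coordinate. -/
theorem Orthonormal.mul_inner_eigen_nonneg
    {H : Type*} [NormedAddCommGroup H] [InnerProductSpace ℝ H] [CompleteSpace H]
    {φ : ℕ → H} (hφ : Orthonormal ℝ φ)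
    (hφtotal : (Submodule.span ℝ (Set.range φ)).topologicalClosure = ⊤)
    {T : H →L[ℝ] H} (hT : IsSelfAdjoint T) {μ : ℕ → ℝ} (hφeig : ∀ j, T (φ j) = μ j • φ j)
    {α β : ℝ} {x : H} (hx : ∀ j, ⟪φ j, x⟫ ≠ 0 → 0 ≤ α + β * μ j) :
    0 ≤ α * ‖x‖ ^ 2 + β * ⟪T x, x⟫ := by
  set e := HilbertBasis.mk hφ hφtotal.ge with he
  have hej : ∀ j, e j = φ j := fun j => by rw [he, HilbertBasis.coe_mk]
  have h1 : HasSum (fun j => ⟪x, φ j⟫ * ⟪φ j, x⟫) (‖x‖ ^ 2) := by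
    have := e.hasSum_inner_mul_inner x x
    rw [real_inner_self_eq_norm_sq] at this
    simpa only [hej] using this
  have h2 : HasSum (fun j => ⟪T x, φ j⟫ * ⟪φ j, x⟫) ⟪T x, x⟫ := by
    simpa only [hej] using e.hasSum_inner_mul_inner (T x) x
  have h3 := (h1.mul_left α).add (h2.mul_left β)
  refine h3.nonneg fun j => ?_
  have h4 : ⟪T x, φ j⟫ = μ j * ⟪φ j, x⟫ := by
    have : ⟪T x, φ j⟫ = ⟪x, T (φ j)⟫ := hT.isSymmetric x (φ j)
    rw [this, hφeig, inner_smul_right, real_inner_comm]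
  rw [h4, real_inner_comm]
  by_cases h0 : ⟪φ j, x⟫ = 0
  · simp [h0]
  · nlinarith [mul_nonneg (hx j h0) (mul_self_nonneg ⟪φ j, x⟫), real_inner_comm x (φ j)]

/-- Vectors of an orthonormal family outside an index set are orthogonal to the span of that
set. -/
theorem Orthonormal.inner_eq_zero_of_mem_span_image
    {H ι : Type*} [NormedAddCommGroup H] [InnerProductSpace ℝ H]
    {φ : ι → H} (hφ : Orthonormal ℝ φ) {s : Set ι} {j : ι} (hj : j ∉ s) {x : H}
    (hx : x ∈ Submodule.span ℝ (φ '' s)) : ⟪φ j, x⟫ = 0 := by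
  induction hx using Submodule.span_induction with
  | mem y hy =>
    obtain ⟨i, hi, rfl⟩ := hy
    exact hφ.2 (by rintro rfl; exact hj hi)
  | zero => simp
  | add y z _ _ hy hz => rw [inner_add_right, hy, hz, add_zero]
  | smul r y _ hy => rw [inner_smul_right, hy, mul_zero]

/-- A spectral gap: positive numbers tending to infinity stay uniformly away (in ratio) from
`[a, b]` when they lie outside the larger interval `[a', b']`. -/
theorem exists_spectral_gap {lam : ℕ → ℝ} (hlampos : ∀ j, 0 < lam j)
    (hlamtop : Tendsto lam atTop atTop) {a b a' b' : ℝ} (ha : a' ≤ a) (hb : b ≤ b') :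
    ∃ c : ℝ, 0 < c ∧ c ≤ 1 ∧ ∀ j, (lam j < a' → c ≤ a * (lam j)⁻¹ - 1) ∧
      (b' < lam j → c ≤ 1 - b * (lam j)⁻¹) := by
  obtain ⟨n, hn⟩ := eventually_atTop.1 (hlamtop.eventually_ge_atTop (max a' (2 * b)))
  have hfin : ∀ m : ℕ, ∃ c : ℝ, 0 < c ∧ c ≤ 1 / 2 ∧ ∀ j < m,
      (lam j < a' → c ≤ a * (lam j)⁻¹ - 1) ∧ (b' < lam j → c ≤ 1 - b * (lam j)⁻¹) := by
    intro m
    induction m with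
    | zero => exact ⟨1 / 2, by norm_num, le_rfl, by simp⟩
    | succ m ih =>
      obtain ⟨c, hc, hc1, h⟩ := ih
      have hm := hlampos m
      have key : ∃ d : ℝ, 0 < d ∧ (lam m < a' → d ≤ a * (lam m)⁻¹ - 1) ∧
          (b' < lam m → d ≤ 1 - b * (lam m)⁻¹) := by
        have h1 : lam m < a' → 0 < a * (lam m)⁻¹ - 1 := fun h => by
          rw [sub_pos, ← div_eq_mul_inv, one_lt_div hm]
          linarith
        have h2 : b' < lam m → 0 < 1 - b * (lam m)⁻¹ := fun h => by
          rw [sub_pos, ← div_eq_mul_inv, div_lt_one hm]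
          linarith
        by_cases p : lam m < a' <;> by_cases q : b' < lam m
        · exact ⟨_, lt_min (h1 p) (h2 q), fun _ => min_le_left _ _, fun _ => min_le_right _ _⟩
        · exact ⟨_, h1 p, fun _ => le_rfl, fun h => absurd h q⟩
        · exact ⟨_, h2 q, fun h => absurd h p, fun _ => le_rfl⟩
        · exact ⟨1, one_pos, fun h => absurd h p, fun h => absurd h q⟩
      obtain ⟨d, hd, hd1, hd2⟩ := key
      refine ⟨min c d, lt_min hc hd, (min_le_left _ _).trans hc1, fun j hj => ?_⟩
      rcases Nat.lt_succ_iff_lt_or_eq.1 hj with hj | rfl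
      · exact ⟨fun p => (min_le_left _ _).trans ((h j hj).1 p),
          fun p => (min_le_left _ _).trans ((h j hj).2 p)⟩
      · exact ⟨fun p => (min_le_right _ _).trans (hd1 p),
          fun p => (min_le_right _ _).trans (hd2 p)⟩
  obtain ⟨c, hc, hc1, h⟩ := hfin n
  refine ⟨c, hc, by linarith, fun j => ?_⟩
  rcases lt_or_ge j n with hj | hj
  · exact h j hj
  · have h1 := max_le_iff.1 (hn j hj)
    refine ⟨fun p => absurd p h1.1.not_gt, fun _ => ?_⟩
    have : b * (lam j)⁻¹ ≤ 1 / 2 := by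
      rw [← div_eq_mul_inv, div_le_iff₀ (hlampos j)]
      linarith
    linarith

/-- Under the hypotheses of the basic estimate (Proposition 1), every vertical
affine subspace `g + V'` of `Y` intersects every sheet `F(v + W)` at exactly
one point; that is, for each `g ∈ Y` and `v ∈ V` there exists a unique `w ∈ W`
such that `F(v + w) ∈ g + V'`.

(Same abstract encoding as in the basic estimate: `X = H¹₀(Ω) = H`,
`Y = H⁻¹(Ω)` identified with `X` via Riesz, `V' = V`, `W = Vᗮ`; membership
`F(v + w) ∈ g + V'` reads `F(v + w) - g ∈ V`.) -/
theorem sheet_meets_vertical_affine_subspace_once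
    {H : Type*} [NormedAddCommGroup H] [InnerProductSpace ℝ H] [CompleteSpace H]
    -- the nonlinearity f, with bounded continuous derivative, a ≤ f' ≤ b
    (f : ℝ → ℝ) (a b : ℝ) (hfdiff : Differentiable ℝ f)
    (hf'cont : Continuous (deriv f)) (hf'bdd : ∀ y : ℝ, deriv f y ∈ Set.Icc a b)
    -- T = (−Δ_D)⁻¹, compact, self-adjoint, positive definite
    (T : H →L[ℝ] H) (hTsa : IsSelfAdjoint T) (hTcpt : IsCompactOperator T)
    (hTpos : ∀ u : H, u ≠ 0 → 0 < ⟪T u, u⟫)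
    -- eigenvalues λ_j of −Δ_D and eigenfunctions φ_j, T φ_j = λ_j⁻¹ φ_j
    (lam : ℕ → ℝ) (hlampos : ∀ j, 0 < lam j) (hlammono : Monotone lam)
    (hlamtop : Tendsto lam atTop atTop)
    (φ : ℕ → H) (hφortho : Orthonormal ℝ φ)
    (hφtotal : (Submodule.span ℝ (Set.range φ)).topologicalClosure = ⊤)
    (hφeig : ∀ j, T (φ j) = (lam j)⁻¹ • φ j)
    -- the interval [a', b'] ⊇ [a, b] and its complete index set J
    (a' b' : ℝ) (ha : a' ≤ a) (hab : a ≤ b) (hb : b ≤ b')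
    (J : Set ℕ) (hJ : J = {j | lam j ∈ Set.Icc a' b'})
    -- the vertical subspace V (= V'), spanned by the φ_j, j ∈ J; W = W' = Vᗮ
    (V : Submodule ℝ H) [FiniteDimensional ℝ V]
    (hV : V = Submodule.span ℝ (φ '' J))
    -- F(u) = −Δu − f(u): C¹ with DF(u) = Id − B(u), B(u) = multiplication by f'(u)
    (F : H → H) (B : H → H →L[ℝ] H)
    (hBsa : ∀ u : H, IsSelfAdjoint (B u)) (hBcont : Continuous B)
    (hBlow : ∀ u h : H, a * ⟪T h, h⟫ ≤ ⟪B u h, h⟫)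
    (hBhigh : ∀ u h : H, ⟪B u h, h⟫ ≤ b * ⟪T h, h⟫)
    (hF : ∀ u : H, HasFDerivAt F (ContinuousLinearMap.id ℝ H - B u) u)
    :
    ∀ g : H, ∀ v ∈ V, ∃! w : H, w ∈ Vᗮ ∧ F (v + w) - g ∈ V := by
  intro g v hv
  obtain ⟨c, hc, hc1, hgap⟩ := exists_spectral_gap hlampos hlamtop ha hb
  set I : Set ℕ := {j | lam j < a'} with hI
  have hIfin : I.Finite := by
    obtain ⟨n, hn⟩ := eventually_atTop.1 (hlamtop.eventually_ge_atTop a')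
    refine (Set.finite_lt_nat n).subset fun j hj => ?_
    by_contra hjn
    exact absurd hj (hn j (not_lt.1 hjn)).not_gt
  set N : Submodule ℝ H := Submodule.span ℝ (φ '' I) with hN
  have : FiniteDimensional ℝ N := FiniteDimensional.span_of_finite ℝ (hIfin.image φ)
  have hIJ : ∀ j ∈ I, j ∉ J := by
    intro j hj hjJ
    rw [hJ] at hjJ
    exact absurd hjJ.1 (not_le.2 hj)
  have hNV : N ≤ Vᗮ := by
    rw [hN, Submodule.span_le]
    rintro _ ⟨j, hj, rfl⟩
    rw [SetLike.mem_coe, Submodule.mem_orthogonal']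
    intro u hu
    rw [hV] at hu
    exact hφortho.inner_eq_zero_of_mem_span_image (hIJ j hj) hu
  set P := V.starProjection with hP
  set Q := Vᗮ.starProjection with hQ
  set R := N.starProjection with hR
  have hRN : ∀ x, R x ∈ N := fun x => N.starProjection_apply_mem x
  have hRorth : ∀ x, x - R x ∈ Nᗮ := fun x => N.sub_starProjection_mem_orthogonal x
  have hQmem : ∀ x, Q x ∈ Vᗮ := fun x => Vᗮ.starProjection_apply_mem x
  have hPmem : ∀ x, P x ∈ V := fun x => V.starProjection_apply_mem x
  have hPQ : ∀ x, P x + Q x = x := fun x => V.starProjection_add_starProjection_orthogonal x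
  have hRR : ∀ x, R (R x) = R x := fun x => Submodule.starProjection_eq_self_iff.2 (hRN x)
  have hRV : ∀ x ∈ V, R x = 0 := fun x hx => by
    rw [hR, Submodule.starProjection_apply_eq_zero_iff, Submodule.mem_orthogonal']
    exact fun u hu => (Submodule.mem_orthogonal V u).1 (hNV hu) x hx
  set S : H →L[ℝ] H := ContinuousLinearMap.id ℝ H - (2 : ℝ) • R with hS
  have hSapp : ∀ x, S x = x - (2 : ℝ) • R x := fun x => rfl
  have hSV : ∀ x ∈ V, S x = x := fun x hx => by rw [hSapp, hRV x hx, smul_zero, sub_zero]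
  have hSS : ∀ x, S (S x) = x := fun x => by
    simp only [hSapp, map_sub, map_smul, hRR]
    module
  have hSsymm : ∀ x y, ⟪S x, y⟫ = ⟪x, S y⟫ := fun x y => by
    have : ⟪R x, y⟫ = ⟪x, R y⟫ := N.starProjection_isSymmetric x y
    simp only [hSapp, inner_sub_left, inner_sub_right, real_inner_smul_left,
      real_inner_smul_right, this]
  have hSmem : ∀ x, S x ∈ V ↔ x ∈ V := fun x =>
    ⟨fun h => by rw [← hSS x, hSV _ h]; exact h, fun h => by rwa [hSV x h]⟩
  have hQsymm : ∀ x y, ⟪Q x, y⟫ = ⟪x, Q y⟫ := fun x y => Vᗮ.starProjection_isSymmetric x y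
  have hQself : ∀ x ∈ Vᗮ, Q x = x := fun x hx => Submodule.starProjection_eq_self_iff.2 hx
  have hSperp : ∀ x ∈ Vᗮ, S x ∈ Vᗮ := fun x hx =>
    Vᗮ.sub_mem hx (Vᗮ.smul_mem _ (hNV (hRN x)))
  have hcoer : ∀ u, ∀ w ∈ Vᗮ, c * ‖w‖ ^ 2 ≤ ⟪w - B u w, S w⟫ := by
    intro u w hw
    set n := R w with hn
    set p := w - R w with hp
    have hwpn : w = p + n := by rw [hp, hn]; abel
    have hSw : S w = p - n := by rw [hSapp, hp, hn]; module
    have hnp : ⟪n, p⟫ = 0 := (Submodule.mem_orthogonal N p).1 (hRorth w) n (hRN w)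
    have hpV : p ∈ Vᗮ := Vᗮ.sub_mem hw (hNV (hRN w))
    have hsymm : ⟪B u n, p⟫ = ⟪B u p, n⟫ := by
      have : ⟪B u n, p⟫ = ⟪n, B u p⟫ := (hBsa u).isSymmetric n p
      rw [this, real_inner_comm]
    have hneg : 0 ≤ -(1 + c) * ‖n‖ ^ 2 + a * ⟪T n, n⟫ := by
      refine hφortho.mul_inner_eigen_nonneg hφtotal hTsa hφeig fun j hj => ?_
      have hjI : j ∈ I := by
        by_contra h
        exact hj (hφortho.inner_eq_zero_of_mem_span_image h (hRN w))
      linarith [(hgap j).1 hjI]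
    have hpos : 0 ≤ (1 - c) * ‖p‖ ^ 2 + (-b) * ⟪T p, p⟫ := by
      refine hφortho.mul_inner_eigen_nonneg hφtotal hTsa hφeig fun j hj => ?_
      have hjI : ¬ lam j < a' := fun h => hj <|
        (Submodule.mem_orthogonal N p).1 (hRorth w) _ (Submodule.subset_span ⟨j, h, rfl⟩)
      have hjJ : j ∉ J := fun h => hj <|
        (Submodule.mem_orthogonal V p).1 hpV _
          (hV ▸ Submodule.subset_span ⟨j, h, rfl⟩)
      have hjb : b' < lam j := by
        by_contra h
        exact hjJ (hJ ▸ ⟨not_lt.1 hjI, not_lt.1 h⟩)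
      linarith [(hgap j).2 hjb]
    have h1 := hBlow u n
    have h2 := hBhigh u p
    have hnorm : ‖w‖ ^ 2 = ‖p‖ ^ 2 + ‖n‖ ^ 2 := by
      rw [hwpn, norm_add_sq_real, real_inner_comm, hnp]
      ring
    have hexp : ⟪w - B u w, S w⟫ = ‖p‖ ^ 2 - ‖n‖ ^ 2 - ⟪B u p, p⟫ + ⟪B u n, n⟫ := by
      rw [hSw, hwpn]
      simp only [map_add, inner_add_left, inner_sub_left, inner_sub_right, hsymm,
        real_inner_self_eq_norm_sq, hnp, real_inner_comm n p]
      ring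
    rw [hnorm, hexp]
    linarith
  have hTnorm : ∀ x, |⟪T x, x⟫| ≤ ‖T‖ * ‖x‖ ^ 2 := fun x => by
    calc |⟪T x, x⟫| ≤ ‖T x‖ * ‖x‖ := abs_real_inner_le_norm _ _
      _ ≤ ‖T‖ * ‖x‖ * ‖x‖ := by gcongr; exact T.le_opNorm x
      _ = ‖T‖ * ‖x‖ ^ 2 := by ring
  set M : ℝ := (|a| + |b|) * ‖T‖ with hM
  have hBnorm : ∀ u, ‖B u‖ ≤ M := fun u => by
    refine (hBsa u).opNorm_le_of_abs_inner_le (by positivity) fun x => ?_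
    have hax : |a * ⟪T x, x⟫| ≤ |a| * (‖T‖ * ‖x‖ ^ 2) := by
      rw [abs_mul]; gcongr; exact hTnorm x
    have hbx : |b * ⟪T x, x⟫| ≤ |b| * (‖T‖ * ‖x‖ ^ 2) := by
      rw [abs_mul]; gcongr; exact hTnorm x
    have ha0 : 0 ≤ |a| * (‖T‖ * ‖x‖ ^ 2) := by positivity
    have hb0 : 0 ≤ |b| * (‖T‖ * ‖x‖ ^ 2) := by positivity
    rw [hM, abs_le]
    constructor
    · linarith [hBlow u x, (abs_le.1 hax).1]
    · linarith [hBhigh u x, (abs_le.1 hbx).2]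
  set Φ : H → H := fun w => P w + Q (S (F (v + Q w) - g)) with hΦ
  set A : H → H →L[ℝ] H := fun w =>
    P + (Q ∘L S) ∘L ((ContinuousLinearMap.id ℝ H - B (v + Q w)) ∘L Q) with hA
  have hΦA : ∀ w, HasFDerivAt Φ (A w) w := fun w => by
    have h1 : HasFDerivAt (fun w => v + Q w) Q w := Q.hasFDerivAt.const_add v
    have h2 := ((hF (v + Q w)).comp w h1).sub_const g
    exact P.hasFDerivAt.add ((Q ∘L S).hasFDerivAt.comp w h2)
  have hAcoer : ∀ w h, c * ‖h‖ ^ 2 ≤ ⟪A w h, h⟫ := fun w h => by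
    have hAh : ⟪A w h, h⟫ = ⟪P h, h⟫ + ⟪Q h - B (v + Q w) (Q h), S (Q h)⟫ := by
      change ⟪P h + Q (S (Q h - B (v + Q w) (Q h))), h⟫ = _
      rw [inner_add_left, hQsymm, hSsymm]
    have hperp : ⟪P h, Q h⟫ = 0 := (Submodule.mem_orthogonal V _).1 (hQmem h) _ (hPmem h)
    have hPh : ⟪P h, h⟫ = ‖P h‖ ^ 2 := by
      have h1 : ⟪P h, h⟫ = ⟪P h, P h + Q h⟫ := by rw [hPQ]
      rw [h1, inner_add_right, hperp, add_zero, real_inner_self_eq_norm_sq]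
    have hnorm : ‖h‖ ^ 2 = ‖P h‖ ^ 2 + ‖Q h‖ ^ 2 := by
      conv_lhs => rw [← hPQ h, norm_add_sq_real, hperp]
      ring
    rw [hAh, hPh, hnorm]
    nlinarith [hcoer (v + Q w) (Q h) (hQmem h), sq_nonneg ‖P h‖]
  have hAnorm : ∀ w, ‖A w‖ ≤ ‖P‖ + ‖Q ∘L S‖ * ((1 + M) * ‖Q‖) := fun w => by
    refine (norm_add_le _ _).trans ?_
    gcongr
    refine (ContinuousLinearMap.opNorm_comp_le _ _).trans ?_
    gcongr
    refine (ContinuousLinearMap.opNorm_comp_le _ _).trans ?_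
    gcongr
    refine (norm_sub_le _ _).trans ?_
    gcongr
    · exact ContinuousLinearMap.norm_id_le
    · exact hBnorm _
  have hzero : ∀ w, Φ w = 0 ↔ w ∈ Vᗮ ∧ F (v + w) - g ∈ V := by
    have hQ0 : ∀ x, Q x = 0 ↔ x ∈ V := fun x => by
      rw [hQ, Submodule.starProjection_apply_eq_zero_iff, Submodule.orthogonal_orthogonal]
    have hP0 : ∀ x, P x = 0 ↔ x ∈ Vᗮ := fun x => by
      rw [hP, Submodule.starProjection_apply_eq_zero_iff]
    intro w
    constructor
    · intro h
      have hPw : P w = 0 := by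
        have hperp : ⟪P w, Q (S (F (v + Q w) - g))⟫ = 0 :=
          (Submodule.mem_orthogonal V _).1 (hQmem _) _ (hPmem w)
        have : ⟪P w, Φ w⟫ = 0 := by rw [h, inner_zero_right]
        rw [hΦ, inner_add_right, hperp, add_zero] at this
        exact inner_self_eq_zero.1 this
      have hw : w ∈ Vᗮ := (hP0 w).1 hPw
      refine ⟨hw, ?_⟩
      rw [hΦ] at h
      simp only [hPw, zero_add, hQself w hw] at h
      exact (hSmem _).1 ((hQ0 _).1 h)
    · rintro ⟨hw, hy⟩
      simp only [hΦ, hQself w hw, (hP0 w).2 hw, zero_add]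
      exact (hQ0 _).2 ((hSmem _).2 hy)
  simpa only [hzero] using existsUnique_zero_of_hasFDerivAt_of_coercive hΦA hc hAcoer hAnorm
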